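/- Let U be a normal ultrafilter on a measurable cardinal δ. If κ is a strong limit cardinal of cofinality δ⁺, then j_U(κ) = κ and there is an unbounded subset of κ that is fresh over Ult(V,U). -/

import Mathlib

noncomputable section

open Cardinal Set

namespace MU

/-- The type of ordinals below the initial ordinal of `δ`, serving as the underlying
set of the cardinal `δ` and indexing the ultrapower. -/
abbrev Idx (δ : Cardinal.{0}) : Type 1 := {o : Ordinal.{0} // o < δ.ord}

/-- A filter `F` is `κ`-complete (equivalently, `<κ`-closed): it is closed under
intersections of fewer than `κ` of its members. -/
def IsCComplete (κ : Cardinal.{0}) {X : Type*} (F : Filter X) : Prop :=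
  ∀ (ι : Type) (t : ι → Set X), #ι < κ → (∀ j, t j ∈ F) → (⋂ j, t j) ∈ F

/-- `U` is a normal ultrafilter on the measurable cardinal `δ`: `δ` is uncountable and
`U` is a `δ`-complete nonprincipal ultrafilter on `δ` such that every function that is
regressive on a set in `U` is constant on a set in `U`. -/
structure IsNormalUltrafilter (δ : Cardinal.{0}) (U : Ultrafilter (Idx δ)) : Prop where
  uncountable : ℵ₀ < δ
  complete : IsCComplete δ (U : Filter (Idx δ))
  nonprincipal : ∀ i : Idx δ, ({i} : Set (Idx δ)) ∉ U
  normal : ∀ f : Idx δ → Ordinal.{0}, { i : Idx δ | f i < i.1 } ∈ U →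
    ∃ c : Ordinal.{0}, { i : Idx δ | f i = c } ∈ U

variable {δ : Cardinal.{0}} {U : Ultrafilter (Idx δ)}

/-- The Łoś ordering on representatives of ordinals of the ultrapower `Ult(V,U)`. -/
def ultLT (U : Ultrafilter (Idx δ)) (f g : Idx δ → Ordinal.{0}) : Prop :=
  { i : Idx δ | f i < g i } ∈ U

theorem ultLT_wf (hU : IsNormalUltrafilter δ U) : WellFounded (ultLT U) := by
  haveI : IsIrrefl (Idx δ → Ordinal.{0}) (ultLT U) := by
    constructor
    intro f hf
    have h : ({ i : Idx δ | f i < f i } : Set (Idx δ)) = ∅ := by ext i; simp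
    rw [ultLT, h] at hf
    exact Filter.empty_notMem (U : Filter (Idx δ)) hf
  haveI : IsTrans (Idx δ → Ordinal.{0}) (ultLT U) := by
    constructor
    intro f g h hfg hgh
    have hsub : ({ i : Idx δ | f i < g i } ∩ { i : Idx δ | g i < h i } : Set (Idx δ)) ⊆
        { i : Idx δ | f i < h i } := fun i hi => show f i < h i from lt_trans hi.1 hi.2
    exact Filter.mem_of_superset (Filter.inter_mem hfg hgh) hsub
  haveI : IsStrictOrder (Idx δ → Ordinal.{0}) (ultLT U) := ⟨⟩
  rw [RelEmbedding.wellFounded_iff_isEmpty]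
  constructor
  intro g
  have hmem : ∀ n : ℕ, { i : Idx δ | g (n + 1) i < g n i } ∈ U :=
    fun n => g.map_rel_iff.2 (Nat.lt_succ_self n)
  have hint : (⋂ n : ℕ, { i : Idx δ | g (n + 1) i < g n i }) ∈ U := by
    refine hU.complete ℕ _ ?_ hmem
    rw [Cardinal.mk_nat]
    exact hU.uncountable
  obtain ⟨i, hi⟩ := Ultrafilter.nonempty_of_mem hint
  have hdesc : ∀ n : ℕ, (fun n => g n i) (n + 1) < (fun n => g n i) n :=
    fun n => Set.mem_iInter.1 hi n
  exact (RelEmbedding.wellFounded_iff_isEmpty.1 Ordinal.lt_wf).false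
    (RelEmbedding.natGT (fun n => g n i) hdesc)

/-- The ordinal represented by `f` in the transitive collapse of the ultrapower
`Ult(V,U)`, i.e. the rank of `f` in the (well-founded) Łoś ordering. -/
def ordRank (hU : IsNormalUltrafilter δ U) (f : Idx δ → Ordinal.{0}) : Ordinal.{0} :=
  sInf { o : Ordinal.{0} | Ordinal.lift.{1} o = ((ultLT_wf hU).apply f).rank }

/-- The image of an ordinal under the ultrapower embedding `j_U : V → Ult(V,U)`. -/
def jU (hU : IsNormalUltrafilter δ U) (o : Ordinal.{0}) : Ordinal.{0} :=
  ordRank hU fun _ => o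

/-- The set of ordinals that is the transitive collapse of the element of the
ultrapower `Ult(V,U)` represented by the function `f`. -/
def ultSet (hU : IsNormalUltrafilter δ U) (f : Idx δ → Set Ordinal.{0}) :
    Set Ordinal.{0} :=
  { o : Ordinal.{0} |
    ∃ g : Idx δ → Ordinal.{0}, { i : Idx δ | g i ∈ f i } ∈ U ∧ ordRank hU g = o }

/-- A set of ordinals is (the transitive collapse of) an element of the ultrapower
`Ult(V,U)`. -/
def InUlt (hU : IsNormalUltrafilter δ U) (A : Set Ordinal.{0}) : Prop :=
  ∃ f : Idx δ → Set Ordinal.{0}, (∀ i, BddAbove (f i)) ∧ A = ultSet hU f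

/-- The least upper bound of a set of ordinals. -/
def lub (A : Set Ordinal.{0}) : Ordinal.{0} :=
  sSup ((fun o => o + 1) '' A)

/-- Hamkins: a set `A` of ordinals is fresh over `Ult(V,U)` if `A ∉ Ult(V,U)` but
`A ∩ α ∈ Ult(V,U)` for every `α < lub A`. -/
def Fresh (hU : IsNormalUltrafilter δ U) (A : Set Ordinal.{0}) : Prop :=
  ¬ InUlt hU A ∧ ∀ α < lub A, InUlt hU (A ∩ Iio α)

/-- `A` is an unbounded subset of the ordinal `l`. -/
def UnbSub (A : Set Ordinal.{0}) (l : Ordinal.{0}) : Prop :=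
  A ⊆ Iio l ∧ ∀ b < l, ∃ a ∈ A, b ≤ a

/-- `A` is a closed subset of the ordinal `l`: it contains the suprema of all of its
nonempty subsets that are bounded below `l`. -/
def ClosedIn (A : Set Ordinal.{0}) (l : Ordinal.{0}) : Prop :=
  ∀ S ⊆ A, S.Nonempty → sSup S < l → sSup S ∈ A

/-- The set of limit points of a set of ordinals. -/
def limitPts (A : Set Ordinal.{0}) : Set Ordinal.{0} :=
  { b : Ordinal.{0} | (A ∩ Iio b).Nonempty ∧ sSup (A ∩ Iio b) = b }

/-- `S` is a stationary subset of the ordinal `l`. -/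
def StationaryIn (S : Set Ordinal.{0}) (l : Ordinal.{0}) : Prop :=
  S ⊆ Iio l ∧ ∀ D : Set Ordinal.{0}, ClosedIn D l → UnbSub D l → (S ∩ D).Nonempty

/-- The order type of the set of ordinals `C` is at most `o`. -/
def otpLE (C : Set Ordinal.{0}) (o : Ordinal.{0}) : Prop :=
  ∃ g : Ordinal.{0} → Ordinal.{0}, (∀ a ∈ C, g a < o) ∧
    ∀ a ∈ C, ∀ b ∈ C, a < b → g a < g b

/-- The order type of the set of ordinals `C` is (strictly) less than `o`. -/
def otpLT (C : Set Ordinal.{0}) (o : Ordinal.{0}) : Prop :=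
  ∃ o' < o, otpLE C o'

/-- `C` is a `□(Θ)`-sequence, where `Θ` is (the initial ordinal of) an uncountable
regular cardinal. -/
structure IsSquareSeq (Θ : Ordinal.{0}) (C : Ordinal.{0} → Set Ordinal.{0}) : Prop where
  closed : ∀ γ < Θ, Order.IsSuccLimit γ → ClosedIn (C γ) γ
  unbounded : ∀ γ < Θ, Order.IsSuccLimit γ → UnbSub (C γ) γ
  coherent : ∀ γ < Θ, Order.IsSuccLimit γ → ∀ β ∈ limitPts (C γ), β < γ → C β = C γ ∩ Iio β
  nontrivial : ¬ ∃ D : Set Ordinal.{0}, ClosedIn D Θ ∧ UnbSub D Θ ∧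
    ∀ γ ∈ limitPts D, γ < Θ → D ∩ Iio γ = C γ

/-- `C` is a `□_κ`-sequence: a `□(κ⁺)`-sequence all of whose clubs have order type
at most `κ`. -/
def IsSquareKappaSeq (κ : Cardinal.{0}) (C : Ordinal.{0} → Set Ordinal.{0}) : Prop :=
  IsSquareSeq (Order.succ κ).ord C ∧
    ∀ γ < (Order.succ κ).ord, Order.IsSuccLimit γ → otpLE (C γ) κ.ord

/-- `κ` is a weakly compact cardinal: `κ` is uncountable and every coloring of the
pairs of ordinals below `κ` in fewer than `κ` colors has a homogeneous set of size `κ`. -/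
def IsWeaklyCompact (κ : Cardinal.{0}) : Prop :=
  ℵ₀ < κ ∧ ∀ (ν : Type) (c : Ordinal.{0} → Ordinal.{0} → ν), #ν < κ →
    ∃ H : Set Ordinal.{0}, H ⊆ Iio κ.ord ∧ Cardinal.lift.{1} κ ≤ #H ∧
      ∀ a ∈ H, ∀ b ∈ H, ∀ a' ∈ H, ∀ b' ∈ H, a < b → a' < b' → c a b = c a' b'

/-- `κ` is a strongly compact cardinal: every `κ`-complete filter (on any set)
extends to a `κ`-complete ultrafilter. -/
def IsStronglyCompact (κ : Cardinal.{0}) : Prop :=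
  ∀ (X : Type) (F : Filter X), IsCComplete κ F →
    ∃ G : Ultrafilter X, F ≤ (G : Filter X) ∧ IsCComplete κ (G : Filter X)

/-- `κ` is a singular cardinal. -/
def IsSingular (κ : Cardinal.{0}) : Prop :=
  ℵ₀ ≤ κ ∧ κ.ord.cof < κ

/-- The cofinality of the ordinal `l` as computed inside the ultrapower `Ult(V,U)`
(as an ordinal, i.e. the image of the ultrapower's cofinality under the transitive
collapse). -/
def cofUlt (hU : IsNormalUltrafilter δ U) (l : Ordinal.{0}) : Ordinal.{0} :=
  sInf { c : Ordinal.{0} | ∃ f : Idx δ → Ordinal.{0},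
    ordRank hU f = l ∧ ordRank hU (fun i => ((f i).cof).ord) = c }

/-- The ordinal `o` is (the transitive collapse of) a cardinal of the ultrapower
`Ult(V,U)`. -/
def CardInUlt (hU : IsNormalUltrafilter δ U) (o : Ordinal.{0}) : Prop :=
  ∃ f : Idx δ → Ordinal.{0}, ordRank hU f = o ∧
    { i : Idx δ | ((f i).card).ord = f i } ∈ U

/-- The ordinal `o` is (the transitive collapse of) a regular cardinal of the
ultrapower `Ult(V,U)`. -/
def RegularInUlt (hU : IsNormalUltrafilter δ U) (o : Ordinal.{0}) : Prop :=
  ∃ f : Idx δ → Ordinal.{0}, ordRank hU f = o ∧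
    { i : Idx δ | ((f i).card).IsRegular ∧ ((f i).card).ord = f i } ∈ U

/-- The cardinal successor of the ordinal `o` as computed inside the ultrapower
`Ult(V,U)`: the least ordinal above `o` that is a cardinal in `Ult(V,U)`. -/
def succInUlt (hU : IsNormalUltrafilter δ U) (o : Ordinal.{0}) : Ordinal.{0} :=
  sInf { c : Ordinal.{0} | o < c ∧ CardInUlt hU c }

/-- The cardinality of a set of ordinals, as an (initial) ordinal: the least ordinal
`o` such that `s` is the image of a function defined on the ordinals below `o`. -/
def setCardOrd (s : Set Ordinal.{0}) : Ordinal.{0} :=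
  sInf { o : Ordinal.{0} | ∃ g : Ordinal.{0} → Ordinal.{0}, s ⊆ g '' Iio o }

theorem mk_idx (δ : Cardinal.{0}) : #(Idx δ) = Cardinal.lift.{1} δ :=
  (Cardinal.mk_Iio_ordinal δ.ord).trans (by rw [Cardinal.card_ord])

theorem mk_Iio_subtype_le {a : Ordinal.{0}} (i : Iio a) :
    #(Iio i) ≤ Cardinal.lift.{1} i.1.card := by
  rw [← Cardinal.mk_Iio_ordinal]
  refine Cardinal.mk_le_of_injective (f := fun k : Iio i => (⟨k.1.1, k.2⟩ : Iio i.1)) ?_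
  exact fun k l h => Subtype.ext (Subtype.ext (Subtype.mk.inj h))

instance (δ : Cardinal.{0}) : Small.{0} (Idx δ) := Ordinal.small_Iio δ.ord

theorem rank_lt_rank (hU : IsNormalUltrafilter δ U) {f g : Idx δ → Ordinal.{0}}
    (h : {i | f i < g i} ∈ U) :
    ((ultLT_wf hU).apply f).rank < ((ultLT_wf hU).apply g).rank :=
  Acc.rank_lt_of_rel ((ultLT_wf hU).apply g) h

theorem rank_le_rank (hU : IsNormalUltrafilter δ U) {f g : Idx δ → Ordinal.{0}}
    (h : {i | f i ≤ g i} ∈ U) :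
    ((ultLT_wf hU).apply f).rank ≤ ((ultLT_wf hU).apply g).rank := by
  rw [Acc.rank_eq, Ordinal.iSup_le_iff]
  rintro ⟨b, hb⟩
  rw [Order.succ_le_iff]
  apply rank_lt_rank hU
  filter_upwards [h, hb] with i h₁ h₂ using h₂.trans_le h₁

theorem not_le_mem {f g : Idx δ → Ordinal.{0}} (h : {i | f i ≤ g i} ∉ U) :
    {i | g i < f i} ∈ U := by
  filter_upwards [Ultrafilter.compl_mem_iff_notMem.2 h] with i hi using not_le.1 hi

/-- Ranks in the ultrapower are controlled by the number of representatives. -/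
theorem card_rank_le (hU : IsNormalUltrafilter δ U) {f : Idx δ → Ordinal.{0}} {β : Ordinal.{0}}
    (hf : ∀ i, f i ≤ β) :
    ((ultLT_wf hU).apply f).rank.card ≤ Cardinal.lift.{1} ((β.card + 1) ^ δ) := by
  have hex : ∀ x : Iio ((ultLT_wf hU).apply f).rank, ∃ h : Idx δ → Iio (β + 1),
      ((ultLT_wf hU).apply fun i => (h i : Ordinal)).rank = x := by
    rintro ⟨x, hx⟩
    obtain ⟨g, _, rfl⟩ := Acc.mem_range_rank_of_le _ (le_of_lt hx)
    have hgf : {i | g i < f i} ∈ U := not_le_mem fun h => (rank_le_rank hU h).not_gt hx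
    refine ⟨fun i => ⟨min (g i) β, mem_Iio.2 (Order.lt_add_one_iff.2 (min_le_right _ _))⟩, ?_⟩
    refine le_antisymm (rank_le_rank hU ?_) (rank_le_rank hU ?_)
    · exact Filter.univ_mem' fun i => (min_le_left (g i) β : _)
    · filter_upwards [hgf] with i hi using le_min le_rfl (hi.le.trans (hf i))
  choose h hh using hex
  have hinj : Function.Injective h := fun x y hxy => Subtype.ext <| by
    rw [← hh x, ← hh y, hxy]
  have := Cardinal.mk_le_of_injective (α := Iio ((ultLT_wf hU).apply f).rank)
    (β := ULift.{2} (Idx δ → Iio (β + 1))) (f := fun x => ⟨h x⟩)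
    fun x y hxy => hinj (ULift.up_injective hxy)
  rw [Cardinal.mk_uLift, Cardinal.mk_Iio_ordinal, Cardinal.lift_le] at this
  refine this.trans_eq ?_
  rw [← Cardinal.power_def, mk_idx, Cardinal.mk_Iio_ordinal, Cardinal.lift_power]
  simp

theorem bddAbove_rep (f : Idx δ → Ordinal.{0}) : ∃ β, ∀ i, f i ≤ β := by
  obtain ⟨β, hβ⟩ := Ordinal.bddAbove_of_small (s := range f)
  exact ⟨β, fun i => hβ ⟨i, rfl⟩⟩

theorem lift_ordRank (hU : IsNormalUltrafilter δ U) (f : Idx δ → Ordinal.{0}) :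
    Ordinal.lift.{1} (ordRank hU f) = ((ultLT_wf hU).apply f).rank := by
  obtain ⟨β, hβ⟩ := bddAbove_rep f
  exact csInf_mem (s := {o : Ordinal.{0} | Ordinal.lift.{1} o = ((ultLT_wf hU).apply f).rank})
    (Ordinal.mem_range_lift_of_card_le (card_rank_le hU hβ))

theorem card_ordRank_le (hU : IsNormalUltrafilter δ U) {f : Idx δ → Ordinal.{0}} {β : Ordinal.{0}}
    (hf : ∀ i, f i ≤ β) : (ordRank hU f).card ≤ (β.card + 1) ^ δ := by
  rw [← Cardinal.lift_le.{1}, Ordinal.lift_card, lift_ordRank]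
  exact card_rank_le hU hf

theorem ordRank_lt_iff (hU : IsNormalUltrafilter δ U) {f g : Idx δ → Ordinal.{0}} :
    ordRank hU f < ordRank hU g ↔ {i | f i < g i} ∈ U := by
  rw [← Ordinal.lift_lt.{1}, lift_ordRank, lift_ordRank]
  refine ⟨fun h => not_le_mem fun h' => (rank_le_rank hU h').not_gt h, rank_lt_rank hU⟩

theorem ordRank_le_iff (hU : IsNormalUltrafilter δ U) {f g : Idx δ → Ordinal.{0}} :
    ordRank hU f ≤ ordRank hU g ↔ {i | f i ≤ g i} ∈ U := by
  rw [← not_lt, ordRank_lt_iff, ← Ultrafilter.compl_mem_iff_notMem]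
  simp [compl_ofPred]

theorem ordRank_eq_iff (hU : IsNormalUltrafilter δ U) {f g : Idx δ → Ordinal.{0}} :
    ordRank hU f = ordRank hU g ↔ {i | f i = g i} ∈ U := by
  rw [le_antisymm_iff, ordRank_le_iff, ordRank_le_iff]
  constructor
  · rintro ⟨h₁, h₂⟩
    filter_upwards [h₁, h₂] with i using le_antisymm
  · intro h
    constructor <;> filter_upwards [h] with i hi
    exacts [hi.le, hi.ge]

theorem le_jU (hU : IsNormalUltrafilter δ U) (o : Ordinal.{0}) : o ≤ jU hU o := by
  have : StrictMono (jU hU) := fun a b hab =>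
    (ordRank_lt_iff hU).2 (Filter.univ_mem' fun _ => hab)
  exact this.le_apply

theorem ordRank_surjective (hU : IsNormalUltrafilter δ U) : Function.Surjective (ordRank hU) := by
  intro o
  have h : Ordinal.lift.{1} o ≤ ((ultLT_wf hU).apply fun _ => o).rank := by
    rw [← lift_ordRank hU, Ordinal.lift_le]
    exact le_jU hU o
  obtain ⟨g, _, hg⟩ := Acc.mem_range_rank_of_le _ h
  refine ⟨g, Ordinal.lift_inj.1 ((lift_ordRank hU g).trans hg)⟩

theorem Ioi_mem (hU : IsNormalUltrafilter δ U) (j : Idx δ) : {i : Idx δ | j < i} ∈ U := by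
  have := hU.complete (j.1 + 1).ToType (fun k => {i | i.1 ≠ (Ordinal.ToType.mk.symm k).1}) ?_ ?_
  · filter_upwards [this] with i hi
    by_contra hij
    simp only [mem_iInter] at hi
    exact hi (Ordinal.ToType.mk ⟨i.1, mem_Iio.2 (Order.lt_add_one_iff.2 (not_lt.1 hij : i ≤ j))⟩) (by simp)
  · rw [Cardinal.mk_toType, ← Cardinal.lt_ord]
    exact (Cardinal.isSuccLimit_ord hU.uncountable.le).add_one_lt j.2
  · intro k
    by_contra hk
    have hk' := Ultrafilter.compl_mem_iff_notMem.2 hk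
    obtain ⟨i, hi⟩ := Ultrafilter.nonempty_of_mem hk'
    refine hU.nonprincipal i (Filter.mem_of_superset hk' fun l hl => Subtype.ext ?_)
    exact (not_not.1 hl).trans (not_not.1 hi).symm

/-- The ultrapower contains every set of at most `δ` ordinals. -/
theorem inUlt_of_subset_range (hU : IsNormalUltrafilter δ U) {B : Set Ordinal.{0}}
    (e : Idx δ → Ordinal.{0}) (hB : B ⊆ range e) : InUlt hU B := by
  choose g hg using fun j => ordRank_surjective hU (e j)
  refine ⟨fun i => (fun j => g j i) '' {j | j < i ∧ e j ∈ B},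
    fun i => Ordinal.bddAbove_of_small, ?_⟩
  ext o
  constructor
  · intro ho
    obtain ⟨j, rfl⟩ := hB ho
    refine ⟨g j, ?_, hg j⟩
    filter_upwards [Ioi_mem hU j] with i hi using ⟨j, ⟨hi, ho⟩, rfl⟩
  · rintro ⟨h, hh, rfl⟩
    have hex : ∀ i, ∃ j : Idx δ, i ∈ {i | h i ∈ (fun j => g j i) '' {j | j < i ∧ e j ∈ B}} →
        j < i ∧ e j ∈ B ∧ g j i = h i := by
      intro i
      by_cases hi : i ∈ {i | h i ∈ (fun j => g j i) '' {j | j < i ∧ e j ∈ B}}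
      · obtain ⟨j, ⟨hj, hj'⟩, hj''⟩ := hi
        exact ⟨j, fun _ => ⟨hj, hj', hj''⟩⟩
      · exact ⟨i, fun h => (hi h).elim⟩
    choose j hj using hex
    obtain ⟨c, hc⟩ := hU.normal (fun i => (j i).1) <| by
      filter_upwards [hh] with i hi using (hj i hi).1
    obtain ⟨i, hi, rfl⟩ := Ultrafilter.nonempty_of_mem (Filter.inter_mem hh hc)
    have : ordRank hU h = e (j i) := by
      rw [← hg, ordRank_eq_iff]
      filter_upwards [hh, hc] with k hk hk'
      rw [← (hj k hk).2.2, Subtype.ext hk']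
    rw [this]
    exact (hj i hi).2.1

/-- If almost every `f i` has an element with at least `δ` predecessors in `f i`, then some initial
segment of the set represented by `f` has more than `δ` elements. -/
theorem exists_not_subset_range (hU : IsNormalUltrafilter δ U) {f : Idx δ → Set Ordinal.{0}}
    (hf : {i | ∃ x ∈ f i, Cardinal.lift.{1} δ ≤ #(f i ∩ Iio x : Set Ordinal.{0})} ∈ U) :
    ∃ a ∈ ultSet hU f, ∀ e : Idx δ → Ordinal.{0}, ¬ ultSet hU f ∩ Iio a ⊆ range e := by
  have hex : ∀ i, ∃ x, i ∈ {i | ∃ x ∈ f i, Cardinal.lift.{1} δ ≤ #(f i ∩ Iio x : Set Ordinal.{0})} →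
      x ∈ f i ∧ Cardinal.lift.{1} δ ≤ #(f i ∩ Iio x : Set Ordinal.{0}) := by
    intro i
    by_cases hi : i ∈ {i | ∃ x ∈ f i, Cardinal.lift.{1} δ ≤ #(f i ∩ Iio x : Set Ordinal.{0})}
    · obtain ⟨x, hx⟩ := hi
      exact ⟨x, fun _ => hx⟩
    · exact ⟨0, fun h => (hi h).elim⟩
  choose x hx using hex
  refine ⟨ordRank hU x, ⟨x, ?_, rfl⟩, fun e he => ?_⟩
  · filter_upwards [hf] with i hi using (hx i hi).1
  choose g hg using fun j => ordRank_surjective hU (e j)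
  have hex : ∀ i, ∃ y, i ∈ {i | ∃ x ∈ f i, Cardinal.lift.{1} δ ≤ #(f i ∩ Iio x : Set Ordinal.{0})} →
      y ∈ f i ∧ y < x i ∧ ∀ j < i, y ≠ g j i := by
    intro i
    by_cases hi : i ∈ {i | ∃ x ∈ f i, Cardinal.lift.{1} δ ≤ #(f i ∩ Iio x : Set Ordinal.{0})}
    · have hlt : #((fun j => g j i) '' Iio i) < #(f i ∩ Iio (x i) : Set Ordinal.{0}) := by
        refine (Cardinal.mk_image_le.trans_lt ?_).trans_le (hx i hi).2
        exact (mk_Iio_subtype_le i).trans_lt (Cardinal.lift_lt.2 (Cardinal.lt_ord.1 i.2))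
      obtain ⟨y, ⟨hy, hy'⟩, hyn⟩ := Cardinal.sdiff_nonempty_of_mk_lt_mk hlt
      exact ⟨y, fun _ => ⟨hy, hy', fun j hj h => hyn ⟨j, hj, h.symm⟩⟩⟩
    · exact ⟨0, fun h => (hi h).elim⟩
  choose y hy using hex
  have hyA : ordRank hU y ∈ ultSet hU f ∩ Iio (ordRank hU x) := by
    refine ⟨⟨y, ?_, rfl⟩, (ordRank_lt_iff hU).2 ?_⟩
    · filter_upwards [hf] with i hi using (hy i hi).1
    · filter_upwards [hf] with i hi using (hy i hi).2.1
  obtain ⟨j, hj⟩ := he hyA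
  rw [← hg, ordRank_eq_iff] at hj
  obtain ⟨i, ⟨hi, hi'⟩, hi''⟩ :=
    Ultrafilter.nonempty_of_mem (Filter.inter_mem (Filter.inter_mem hf hj) (Ioi_mem hU j))
  exact (hy i hi).2.2 j hi'' hi'.symm

theorem sSup_add_one_lt_ord {κ : Cardinal.{0}} (hcof : κ.ord.cof = Order.succ δ)
    {S : Set Ordinal.{0}} (hS : #S ≤ Cardinal.lift.{1} δ) (hSκ : ∀ x ∈ S, x < κ.ord) :
    sSup ((· + 1) '' S) < κ.ord := by
  apply Ordinal.sSup_add_one_lt_of_lt_cof _ hSκ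
  rw [← Ordinal.lift_cof, hcof]
  exact hS.trans_lt (Cardinal.lift_lt.2 (Order.lt_succ δ))

theorem lt_sSup_add_one {S : Set Ordinal.{0}} (hS : BddAbove S) {x : Ordinal.{0}} (hx : x ∈ S) :
    x < sSup ((· + 1) '' S) := by
  obtain ⟨b, hb⟩ := hS
  refine (Order.lt_add_one_iff.2 le_rfl).trans_le (le_csSup ⟨b + 1, ?_⟩ ⟨x, hx, rfl⟩)
  rintro _ ⟨y, hy, rfl⟩
  exact add_le_add_left (hb hy) 1

theorem exists_ge_of_lt_ord {κ : Cardinal.{0}} (hcof : κ.ord.cof = Order.succ δ)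
    {S : Set Ordinal.{0}} (hS : ∀ b < κ.ord, ∃ x ∈ S, b ≤ x ∧ x < κ.ord) :
    ∃ x ∈ S, Cardinal.lift.{1} δ ≤ #(S ∩ Iio x : Set Ordinal.{0}) := by
  have hle : Cardinal.lift.{1} δ ≤ #(S ∩ Iio κ.ord : Set Ordinal.{0}) := by
    by_contra! h
    obtain ⟨x, hxS, hbx, hx⟩ := hS _ (sSup_add_one_lt_ord hcof h.le fun x hx => hx.2)
    exact (lt_sSup_add_one ⟨κ.ord, fun y hy => (hy.2 : y < κ.ord).le⟩
      (⟨hxS, hx⟩ : x ∈ S ∩ Iio κ.ord)).not_ge hbx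
  obtain ⟨T, hTS, hT⟩ := Cardinal.le_mk_iff_exists_subset.1 hle
  obtain ⟨x, hxS, hbx, hx⟩ := hS _ (sSup_add_one_lt_ord hcof hT.le fun x hx => (hTS hx).2)
  refine ⟨x, hxS, hT.symm.le.trans (Cardinal.mk_le_mk_of_subset fun y hy => ⟨(hTS hy).1, ?_⟩)⟩
  exact (lt_sSup_add_one ⟨κ.ord, fun y hy => ((hTS hy).2 : y < κ.ord).le⟩ hy).trans_le hbx

theorem lt_of_cof_eq_succ {κ : Cardinal.{0}} (hcof : κ.ord.cof = Order.succ δ) : δ < κ :=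
  Order.succ_le_iff.1 (hcof ▸ Ordinal.cof_ord_le κ)

theorem jU_ord_eq (hU : IsNormalUltrafilter δ U) {κ : Cardinal.{0}} (hsl : κ.IsStrongLimit)
    (hcof : κ.ord.cof = Order.succ δ) : jU hU κ.ord = κ.ord := by
  refine le_antisymm (le_of_forall_lt fun o ho => ?_) (le_jU hU _)
  obtain ⟨g, rfl⟩ := ordRank_surjective hU o
  have hg := (ordRank_lt_iff hU).1 ho
  have hκ : 0 < κ.ord := by simpa using hsl.aleph0_le.trans_lt' Cardinal.aleph0_pos
  set g' : Idx δ → Ordinal.{0} := fun i => if g i < κ.ord then g i else 0 with hg'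
  have hg'κ : ∀ i, g' i < κ.ord := fun i => by
    simp only [hg']
    split_ifs with h
    exacts [h, hκ]
  have hgg' : ordRank hU g = ordRank hU g' := by
    rw [ordRank_eq_iff]
    filter_upwards [hg] with i hi
    simp only [hg', if_pos (show g i < κ.ord from hi)]
  have hβ := sSup_add_one_lt_ord hcof (S := range g') (Cardinal.mk_range_le.trans_eq (mk_idx δ))
    (by rintro _ ⟨i, rfl⟩; exact hg'κ i)
  set β := sSup ((· + 1) '' range g')
  rw [hgg', Cardinal.lt_ord]
  refine (card_ordRank_le hU (β := β) fun i => ?_).trans_lt ?_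
  · exact (lt_sSup_add_one Ordinal.bddAbove_of_small (mem_range_self i)).le
  have hδ := lt_of_cof_eq_succ hcof
  set μ := max (β.card + 1) δ
  have hμ : μ < κ := max_lt (Cardinal.add_lt_of_lt hsl.aleph0_le (Cardinal.lt_ord.1 hβ)
    (hsl.aleph0_le.trans_lt' Cardinal.one_lt_aleph0)) hδ
  have hμ' : ℵ₀ ≤ μ := hU.uncountable.le.trans (le_max_right _ _)
  calc (β.card + 1) ^ δ ≤ μ ^ δ := Cardinal.power_le_power_right (le_max_left _ _)
    _ ≤ μ ^ μ := Cardinal.power_le_power_left (Cardinal.aleph0_pos.trans_le hμ').ne'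
      (le_max_right _ _)
    _ = 2 ^ μ := Cardinal.power_self_eq hμ'
    _ < κ := hsl.isStrongPrelimit hμ

/-- An unbounded subset of `κ` all of whose proper initial segments have size at most `δ`. -/
theorem exists_unbSub {κ : Cardinal.{0}} (hcof : κ.ord.cof = Order.succ δ) :
    ∃ A : Set Ordinal.{0}, UnbSub A κ.ord ∧
      ∀ a < κ.ord, #(A ∩ Iio a : Set Ordinal.{0}) ≤ Cardinal.lift.{1} δ := by
  obtain ⟨F, hF⟩ := Ordinal.exists_isFundamentalSeq (o := κ.ord) (congrArg Cardinal.ord hcof)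
  refine ⟨range fun i => (F i).1, ⟨?_, ?_⟩, ?_⟩
  · rintro _ ⟨i, rfl⟩
    exact (F i).2
  · intro b hb
    obtain ⟨_, ⟨i, rfl⟩, hi⟩ := hF.isCofinal_range ⟨b, hb⟩
    exact ⟨_, ⟨i, rfl⟩, hi⟩
  · intro a ha
    obtain ⟨_, ⟨i, rfl⟩, hi⟩ := hF.isCofinal_range ⟨a, ha⟩
    have hsub : (range (fun i => (F i).1) ∩ Iio a) ⊆ (fun i => (F i).1) '' Iio i := by
      rintro _ ⟨⟨k, rfl⟩, hk⟩
      exact ⟨k, hF.strictMono.lt_iff_lt.1 (Subtype.coe_lt_coe.1 (lt_of_lt_of_le hk hi)), rfl⟩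
    refine (Cardinal.mk_le_mk_of_subset hsub).trans (Cardinal.mk_image_le.trans ?_)
    refine (mk_Iio_subtype_le i).trans (Cardinal.lift_le.2 ?_)
    exact Order.lt_succ_iff.1 (Cardinal.lt_ord.1 i.2)

theorem exists_subset_range {B : Set Ordinal.{0}} (hB : #B ≤ Cardinal.lift.{1} δ) :
    ∃ e : Idx δ → Ordinal.{0}, B ⊆ range e := by
  rw [← mk_idx, Cardinal.le_def] at hB
  obtain ⟨φ⟩ := hB
  refine ⟨fun i => Function.extend φ Subtype.val 0 i, fun b hb => ⟨φ ⟨b, hb⟩, ?_⟩⟩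
  exact φ.injective.extend_apply _ _ _

/-- If `κ` is a strong limit cardinal of cofinality `δ⁺`, then `j_U(κ) = κ` and
there is an unbounded subset of `κ` that is fresh over `Ult(V,U)`. -/
theorem stmt6 (δ : Cardinal.{0}) (U : Ultrafilter (Idx δ)) (hU : IsNormalUltrafilter δ U)
    (κ : Cardinal.{0}) (hsl : κ.IsStrongLimit) (hcof : κ.ord.cof = Order.succ δ) :
    jU hU κ.ord = κ.ord ∧ ∃ A : Set Ordinal.{0}, UnbSub A κ.ord ∧ Fresh hU A := by
  have hj := jU_ord_eq hU hsl hcof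
  obtain ⟨A, hA, hAδ⟩ := exists_unbSub hcof
  refine ⟨hj, A, hA, ?_, fun α hα => ?_⟩
  · rintro ⟨f, -, rfl⟩
    have hf : {i | ∃ x ∈ f i, Cardinal.lift.{1} δ ≤ #(f i ∩ Iio x : Set Ordinal.{0})} ∈ U := by
      by_contra hf
      have hf' := Ultrafilter.compl_mem_iff_notMem.2 hf
      have hex : ∀ i, ∃ b < κ.ord,
          i ∈ {i | ∃ x ∈ f i, Cardinal.lift.{1} δ ≤ #(f i ∩ Iio x : Set Ordinal.{0})}ᶜ →
          ∀ x ∈ f i, b ≤ x → κ.ord ≤ x := by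
        intro i
        by_contra! h
        exact (h 0 (by simpa using hsl.aleph0_le.trans_lt' Cardinal.aleph0_pos)).1
          (exists_ge_of_lt_ord hcof fun b hb => (h b hb).2)
      choose h hκ hh using hex
      have hlt : ordRank hU h < κ.ord := by
        rw [← hj]
        exact (ordRank_lt_iff hU).2 (Filter.univ_mem' hκ)
      obtain ⟨_, ⟨g, hg, rfl⟩, hle⟩ := hA.2 _ hlt
      have hgκ : ordRank hU g < jU hU κ.ord := by
        rw [hj]
        exact hA.1 ⟨g, hg, rfl⟩
      obtain ⟨i, ⟨⟨h₁, h₂⟩, h₃⟩, h₄⟩ := Ultrafilter.nonempty_of_mem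
        (Filter.inter_mem (Filter.inter_mem (Filter.inter_mem hf' hg)
          ((ordRank_le_iff hU).1 hle)) ((ordRank_lt_iff hU).1 hgκ))
      exact (hh i h₁ _ h₂ h₃).not_gt h₄
    obtain ⟨a, ha, hna⟩ := exists_not_subset_range hU hf
    obtain ⟨e, he⟩ := exists_subset_range (hAδ a (hA.1 ha))
    exact hna e he
  · have hακ : α < κ.ord := hα.trans_le <| by
      refine csSup_le' ?_
      rintro _ ⟨x, hx, rfl⟩
      exact Order.add_one_le_iff.2 (hA.1 hx)
    obtain ⟨e, he⟩ := exists_subset_range (hAδ α hακ)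
    exact inUlt_of_subset_range hU e he

end MU
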